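/- Let X_1, X_2, X_3 be independent uniform random points in a tetrahedron T of volume 1 and c the centroid of a facet of T. Then E[vol(conv{X_1,X_2,X_3,c})^4] = 43/27783000. -/

import Mathlib

open MeasureTheory

/-- The solid standard simplex in `ℝ³`. -/
def solidSimplex : Set (Fin 3 → ℝ) :=
  {y | 0 ≤ y 0 ∧ 0 ≤ y 1 ∧ 0 ≤ y 2 ∧ y 0 + y 1 + y 2 ≤ 1}

theorem integral_pow_mul_sub_pow (s : ℝ) (b n : ℕ) :
    ∫ y in (0 : ℝ)..s, y ^ b * (s - y) ^ n =
      (b.factorial * n.factorial : ℝ) / (b + n + 1).factorial * s ^ (b + n + 1) := by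
  induction b generalizing n with
  | zero =>
    have h := intervalIntegral.integral_comp_sub_left (fun y : ℝ => y ^ n) s (a := 0) (b := s)
    simp only [sub_self, sub_zero, integral_pow] at h
    simp only [pow_zero, one_mul, h, Nat.factorial, zero_add]
    have := Nat.factorial_ne_zero n
    push_cast
    field_simp
    simp
  | succ b ih =>
    have hu : ∀ x ∈ Set.uIcc (0 : ℝ) s, HasDerivAt (fun y : ℝ => y ^ (b + 1))
        ((b + 1 : ℝ) * x ^ b) x := fun x _ => by
      simpa using hasDerivAt_pow (b + 1) x
    have hw : ∀ x ∈ Set.uIcc (0 : ℝ) s,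
        HasDerivAt (fun y : ℝ => -((s - y) ^ (n + 1) / (n + 1))) ((s - x) ^ n) x := fun x _ => by
      have h := ((((hasDerivAt_id x).const_sub s).pow (n + 1)).div_const (n + 1 : ℝ)).neg
      have : (n + 1 : ℝ) ≠ 0 := by positivity
      refine HasDerivAt.congr_deriv h ?_
      rw [Nat.add_sub_cancel]
      push_cast
      field_simp
      simp
    rw [intervalIntegral.integral_mul_deriv_eq_deriv_mul hu hw
      (Continuous.intervalIntegrable (by fun_prop) _ _)
      (Continuous.intervalIntegrable (by fun_prop) _ _)]
    have h : ∀ x : ℝ, (b + 1 : ℝ) * x ^ b * -((s - x) ^ (n + 1) / (n + 1)) =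
        -((b + 1 : ℝ) / (n + 1)) * (x ^ b * (s - x) ^ (n + 1)) := fun x => by ring
    simp only [h, intervalIntegral.integral_const_mul, ih]
    have e : b + (n + 1) + 1 = b + 1 + n + 1 := by ring
    have : (n + 1 : ℝ) ≠ 0 := by positivity
    have := Nat.factorial_ne_zero (b + 1 + n + 1)
    rw [e, Nat.factorial_succ b, Nat.factorial_succ n]
    push_cast
    simp
    field_simp

theorem isCompact_solidSimplex : IsCompact solidSimplex := by
  refine (isCompact_Icc (a := (0 : Fin 3 → ℝ)) (b := 1)).of_isClosed_subset ?_ ?_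
  · simp only [solidSimplex, Set.ofPred_and]
    exact (isClosed_le (by fun_prop) (by fun_prop)).inter ((isClosed_le (by fun_prop)
      (by fun_prop)).inter ((isClosed_le (by fun_prop) (by fun_prop)).inter
      (isClosed_le (by fun_prop) (by fun_prop))))
  · rintro y ⟨h0, h1, h2, h3⟩
    refine ⟨fun i => ?_, fun i => ?_⟩ <;> fin_cases i <;> simp <;> linarith

theorem integral_solidSimplex (f : ℝ → ℝ → ℝ → ℝ)
    (hf : Continuous fun p : ℝ × ℝ × ℝ => f p.1 p.2.1 p.2.2) :
    ∫ y in solidSimplex, f (y 0) (y 1) (y 2) =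
      ∫ x in (0 : ℝ)..1, ∫ y in (0 : ℝ)..(1 - x), ∫ z in (0 : ℝ)..(1 - x - y), f x y z := by
  let S : Set (ℝ × ℝ × ℝ) :=
    {p | 0 ≤ p.1 ∧ 0 ≤ p.2.1 ∧ 0 ≤ p.2.2 ∧ p.1 + p.2.1 + p.2.2 ≤ 1}
  have hSc : IsClosed S := by
    simp only [S, Set.ofPred_and]
    exact (isClosed_le (by fun_prop) (by fun_prop)).inter ((isClosed_le (by fun_prop)
      (by fun_prop)).inter ((isClosed_le (by fun_prop) (by fun_prop)).inter
      (isClosed_le (by fun_prop) (by fun_prop))))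
  have hS : IsCompact S := by
    refine (isCompact_Icc (a := ((0, 0, 0) : ℝ × ℝ × ℝ)) (b := (1, 1, 1))).of_isClosed_subset hSc ?_
    rintro ⟨x, y, z⟩ ⟨h0, h1, h2, h3⟩
    simp only at h0 h1 h2 h3
    refine ⟨⟨h0, h1, h2⟩, ?_, ?_, ?_⟩ <;> simp <;> linarith
  let g : ℝ × ℝ × ℝ → ℝ := fun p => f p.1 p.2.1 p.2.2
  have hint : Integrable (S.indicator g) :=
    (integrable_indicator_iff hSc.measurableSet).2 (hf.continuousOn.integrableOn_compact hS)
  have hmp : MeasurePreserving (fun y : Fin 3 → ℝ => (y 0, y 1, y 2)) := by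
    have h := ((MeasurePreserving.id (volume : Measure ℝ)).prod (volume_preserving_finTwoArrow ℝ)).comp
      (volume_preserving_piFinSuccAbove (fun _ : Fin 3 => ℝ) 0)
    exact h
  have hemb : MeasurableEmbedding (fun y : Fin 3 → ℝ => (y 0, y 1, y 2)) := by
    have h := (((MeasurableEquiv.piFinSuccAbove (fun _ : Fin 3 => ℝ) 0).trans
      ((MeasurableEquiv.refl ℝ).prodCongr (MeasurableEquiv.finTwoArrow)))).measurableEmbedding
    exact h
  have h1 : ∫ y in solidSimplex, f (y 0) (y 1) (y 2) = ∫ p, S.indicator g p := by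
    rw [integral_indicator hSc.measurableSet]
    exact hmp.setIntegral_preimage_emb hemb g S
  rw [h1, Measure.volume_eq_prod, integral_prod _ hint]
  have h2 : ∀ᵐ x : ℝ, ∫ q : ℝ × ℝ, S.indicator g (x, q) =
      (Set.Icc 0 1).indicator
        (fun x => ∫ y in (0 : ℝ)..(1 - x), ∫ z in (0 : ℝ)..(1 - x - y), f x y z) x := by
    filter_upwards [hint.prod_right_ae] with x hx
    rw [Measure.volume_eq_prod, integral_prod _ hx]
    have h3 : ∀ y : ℝ, ∫ z : ℝ, S.indicator g (x, y, z) = (Set.Icc 0 1).indicator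
        (fun x => (Set.Icc 0 (1 - x)).indicator
          (fun y => ∫ z in (0 : ℝ)..(1 - x - y), f x y z) y) x := by
      intro y
      by_cases hx : x ∈ Set.Icc (0 : ℝ) 1
      · rw [Set.indicator_of_mem hx]
        by_cases hy : y ∈ Set.Icc (0 : ℝ) (1 - x)
        · rw [Set.indicator_of_mem hy, intervalIntegral.integral_of_le (by linarith [hy.2]),
            ← integral_Icc_eq_integral_Ioc, ← integral_indicator measurableSet_Icc]
          congr 1 with z
          simp only [Set.indicator, S, g, Set.mem_ofPred_eq, Set.mem_Icc]
          congr 1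
          simp only [eq_iff_iff]
          exact ⟨fun h => ⟨h.2.2.1, by linarith [h.2.2.2]⟩,
            fun h => ⟨hx.1, hy.1, h.1, by linarith [h.2]⟩⟩
        · rw [Set.indicator_of_notMem hy, ← integral_zero ℝ ℝ]
          congr 1 with z
          refine Set.indicator_of_notMem (fun h => hy ⟨h.2.1, ?_⟩) _
          have h3 := h.2.2.1
          have h4 := h.2.2.2
          simp only at h3 h4
          linarith
      · rw [Set.indicator_of_notMem hx, ← integral_zero ℝ ℝ]
        congr 1 with z
        refine Set.indicator_of_notMem (fun h => hx ⟨h.1, ?_⟩) _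
        have h2 := h.2.1
        have h3 := h.2.2.1
        have h4 := h.2.2.2
        simp only at h2 h3 h4
        linarith
    simp only [h3]
    by_cases hx : x ∈ Set.Icc (0 : ℝ) 1
    · simp only [Set.indicator_of_mem hx]
      rw [integral_indicator measurableSet_Icc, integral_Icc_eq_integral_Ioc,
        intervalIntegral.integral_of_le (by linarith [hx.2])]
    · simp only [Set.indicator_of_notMem hx, integral_zero]
  rw [integral_congr_ae h2, integral_indicator measurableSet_Icc, integral_Icc_eq_integral_Ioc,
    intervalIntegral.integral_of_le zero_le_one]

theorem integral_monomial_solidSimplex (a b c : ℕ) :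
    ∫ y in solidSimplex, y 0 ^ a * y 1 ^ b * y 2 ^ c =
      (a.factorial * b.factorial * c.factorial : ℝ) / (a + b + c + 3).factorial := by
  rw [integral_solidSimplex (fun x y z => x ^ a * y ^ b * z ^ c) (by fun_prop)]
  have h1 : ∀ x y : ℝ, ∫ z in (0 : ℝ)..(1 - x - y), x ^ a * y ^ b * z ^ c =
      x ^ a / (c + 1) * (y ^ b * (1 - x - y) ^ (c + 1)) := fun x y => by
    rw [intervalIntegral.integral_const_mul, integral_pow]
    simp
    ring
  have h2 : ∀ x : ℝ, x ^ a / (c + 1) * ((b.factorial * (c + 1).factorial : ℝ) /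
      (b + (c + 1) + 1).factorial * (1 - x) ^ (b + (c + 1) + 1)) =
      ((b.factorial * c.factorial : ℝ) / (b + (c + 1) + 1).factorial) *
        (x ^ a * (1 - x) ^ (b + (c + 1) + 1)) := fun x => by
    rw [Nat.factorial_succ c]
    push_cast
    have : (c + 1 : ℝ) ≠ 0 := by positivity
    field_simp
  simp only [h1, intervalIntegral.integral_const_mul, integral_pow_mul_sub_pow, h2]
  have e : a + (b + (c + 1) + 1) + 1 = a + b + c + 3 := by ring
  have := Nat.factorial_ne_zero (b + (c + 1) + 1)
  rw [e, one_pow]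
  field_simp

theorem volume_solidSimplex : volume solidSimplex = ENNReal.ofReal (1 / 6) := by
  have h := integral_monomial_solidSimplex 0 0 0
  simp only [pow_zero, mul_one, setIntegral_const, smul_eq_mul] at h
  rw [← ENNReal.ofReal_toReal isCompact_solidSimplex.measure_lt_top.ne]
  congr 1
  rw [← measureReal_def, h]
  norm_num [Nat.factorial]

theorem integral_affine_pow_four_solidSimplex (α β γ δ : ℝ) :
    ∫ y in solidSimplex, (α * y 0 + β * y 1 + γ * y 2 + δ) ^ 4 =
      ∑ k ∈ Finset.range 5, ∑ j ∈ Finset.range (k + 1), ∑ i ∈ Finset.range (j + 1),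
        (Nat.choose 4 k * Nat.choose k j * Nat.choose j i : ℝ) *
          (α ^ i * β ^ (j - i) * γ ^ (k - j) * δ ^ (4 - k)) *
          ((i.factorial * (j - i).factorial * (k - j).factorial : ℝ) /
            (i + (j - i) + (k - j) + 3).factorial) := by
  have h : ∀ y : Fin 3 → ℝ, (α * y 0 + β * y 1 + γ * y 2 + δ) ^ 4 =
      ∑ k ∈ Finset.range 5, ∑ j ∈ Finset.range (k + 1), ∑ i ∈ Finset.range (j + 1),
        (Nat.choose 4 k * Nat.choose k j * Nat.choose j i : ℝ) *
          (α ^ i * β ^ (j - i) * γ ^ (k - j) * δ ^ (4 - k)) *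
          (y 0 ^ i * y 1 ^ (j - i) * y 2 ^ (k - j)) := fun y => by
    rw [add_pow]
    refine Finset.sum_congr rfl fun k _ => ?_
    rw [add_pow, Finset.sum_mul, Finset.sum_mul]
    refine Finset.sum_congr rfl fun j _ => ?_
    rw [add_pow, Finset.sum_mul, Finset.sum_mul, Finset.sum_mul, Finset.sum_mul]
    refine Finset.sum_congr rfl fun i _ => ?_
    simp only [mul_pow]
    ring
  have hi : ∀ g : (Fin 3 → ℝ) → ℝ, Continuous g → IntegrableOn g solidSimplex :=
    fun g hg => hg.continuousOn.integrableOn_compact isCompact_solidSimplex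
  simp only [h]
  rw [integral_finsetSum _ fun k _ => hi _ (by fun_prop)]
  refine Finset.sum_congr rfl fun k _ => ?_
  rw [integral_finsetSum _ fun k _ => hi _ (by fun_prop)]
  refine Finset.sum_congr rfl fun j _ => ?_
  rw [integral_finsetSum _ fun k _ => hi _ (by fun_prop)]
  refine Finset.sum_congr rfl fun i _ => ?_
  rw [integral_const_mul, integral_monomial_solidSimplex]

/-- The weights of a cubature rule for quartic forms. -/
noncomputable def cubatureWeight : Fin 7 → ℝ :=
  ![5 / 12, 5 / 12, 5 / 12, 3 / 4, 1 / 12, 1 / 12, 1 / 12]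

/-- The nodes of a cubature rule that integrates quartic forms in `y - (1/3, 1/3, 0)` exactly over
`solidSimplex`. -/
noncomputable def cubatureNode : Fin 7 → Fin 3 → ℝ :=
  ![![2 / 3, -1 / 3, 0], ![-1 / 3, 2 / 3, 0], ![-1 / 3, -1 / 3, 0], ![-1 / 3, -1 / 3, 1],
    ![1 / 3, -2 / 3, 1], ![-2 / 3, 1 / 3, 1], ![-2 / 3, -2 / 3, 1]]

theorem integral_linear_pow_four_solidSimplex (p q r : ℝ) :
    ∫ y in solidSimplex, (p * (y 0 - 1 / 3) + q * (y 1 - 1 / 3) + r * y 2) ^ 4 =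
      1 / 210 * ∑ j, cubatureWeight j *
        (p * cubatureNode j 0 + q * cubatureNode j 1 + r * cubatureNode j 2) ^ 4 := by
  have h : ∀ y : Fin 3 → ℝ, (p * (y 0 - 1 / 3) + q * (y 1 - 1 / 3) + r * y 2) ^ 4 =
    (p * y 0 + q * y 1 + r * y 2 + (-(p + q) / 3)) ^ 4 := fun y => by ring
  simp only [h, integral_affine_pow_four_solidSimplex]
  simp [Finset.sum_range_succ, Nat.factorial, Nat.choose, Fin.sum_univ_succ, cubatureWeight,
    cubatureNode]
  ring

/-- The facet centroid `(1/3, 1/3, 0)` of `solidSimplex`. -/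
noncomputable def facetCentroid : Fin 3 → ℝ := ![1 / 3, 1 / 3, 0]

theorem integral_det_pow_four_solidSimplex (u v : Fin 3 → ℝ) :
    ∫ y in solidSimplex, (Matrix.of ![u, v, y - facetCentroid]).det ^ 4 =
      1 / 210 * ∑ j, cubatureWeight j * (Matrix.of ![u, v, cubatureNode j]).det ^ 4 := by
  have h (w : Fin 3 → ℝ) : (Matrix.of ![u, v, w]).det =
      (u 1 * v 2 - u 2 * v 1) * w 0 + (u 2 * v 0 - u 0 * v 2) * w 1 +
        (u 0 * v 1 - u 1 * v 0) * w 2 := by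
    simp [Matrix.det_fin_three]
    ring
  simp only [h, ← integral_linear_pow_four_solidSimplex]
  simp [facetCentroid]

theorem det_rows_rotate (u v w : Fin 3 → ℝ) :
    (Matrix.of ![u, v, w]).det = (Matrix.of ![w, u, v]).det := by
  simp [Matrix.det_fin_three]
  ring

theorem det_pow_four_rows_swap (u v w : Fin 3 → ℝ) :
    (Matrix.of ![u, v, w]).det ^ 4 = (Matrix.of ![u, w, v]).det ^ 4 := by
  simp [Matrix.det_fin_three]
  ring

theorem triple_integral_det_pow_four_solidSimplex :
    ∫ y₁ in solidSimplex, ∫ y₂ in solidSimplex, ∫ y₃ in solidSimplex,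
      (Matrix.of ![y₁ - facetCentroid, y₂ - facetCentroid, y₃ - facetCentroid]).det ^ 4 =
      (1 / 210) ^ 3 * (43 / 648) := by
  have hi : ∀ g : (Fin 3 → ℝ) → ℝ, Continuous g → IntegrableOn g solidSimplex :=
    fun g hg => hg.continuousOn.integrableOn_compact isCompact_solidSimplex
  have hc (a b : Fin 3 → ℝ) : Continuous fun y : Fin 3 → ℝ =>
      (Matrix.of ![a, b, y - facetCentroid]).det ^ 4 := by
    simp only [Matrix.det_fin_three]
    simp
    fun_prop
  have h2 (u : Fin 3 → ℝ) : ∫ y₂ in solidSimplex, ∫ y₃ in solidSimplex,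
      (Matrix.of ![u, y₂ - facetCentroid, y₃ - facetCentroid]).det ^ 4 =
      (1 / 210) ^ 2 * ∑ k, ∑ j, cubatureWeight k * cubatureWeight j *
        (Matrix.of ![cubatureNode k, cubatureNode j, u]).det ^ 4 := by
    simp only [integral_det_pow_four_solidSimplex]
    rw [integral_const_mul]
    simp only [det_rows_rotate u _ (cubatureNode _)]
    rw [integral_finsetSum _ fun k _ => (hi _ (hc _ _)).const_mul _]
    simp only [integral_const_mul, integral_det_pow_four_solidSimplex, Finset.mul_sum]
    refine Finset.sum_congr rfl fun k _ => Finset.sum_congr rfl fun j _ => ?_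
    rw [det_pow_four_rows_swap]
    ring
  simp only [h2]
  rw [integral_const_mul, integral_finsetSum _ fun k _ => integrable_finsetSum _
    fun j _ => (hi _ (hc _ _)).const_mul _]
  simp only [integral_finsetSum _ fun j _ => (hi _ (hc _ _)).const_mul _, integral_const_mul,
    integral_det_pow_four_solidSimplex]
  have hs : ∑ k, ∑ j, cubatureWeight k * cubatureWeight j * (1 / 210 * ∑ i, cubatureWeight i *
      (Matrix.of ![cubatureNode k, cubatureNode j, cubatureNode i]).det ^ 4) =
      1 / 210 * (43 / 648) := by
    simp only [Matrix.det_fin_three]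
    simp [Fin.sum_univ_succ, cubatureWeight, cubatureNode]
    norm_num
  rw [hs]
  ring

/-- The affine map sending the vertices of `solidSimplex` to `a`, `b`, `c` and the origin to `d`. -/
noncomputable def simplexMap (a b c d : Fin 3 → ℝ) (y : Fin 3 → ℝ) : Fin 3 → ℝ :=
  Matrix.toLin' (Matrix.of ![a - d, b - d, c - d]).transpose y + d

theorem simplexMap_apply (a b c d y : Fin 3 → ℝ) :
    simplexMap a b c d y =
      y 0 • a + y 1 • b + y 2 • c + (1 - y 0 - y 1 - y 2) • d := by
  ext i
  simp [simplexMap, Matrix.mulVec, dotProduct, Fin.sum_univ_three]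
  ring

theorem convexHull_eq_image_simplexMap (a b c d : Fin 3 → ℝ) :
    convexHull ℝ {a, b, c, d} = simplexMap a b c d '' solidSimplex := by
  refine Set.Subset.antisymm (convexHull_min ?_ ?_) ?_
  · rintro x (rfl | rfl | rfl | rfl)
    · exact ⟨![1, 0, 0], by simp [solidSimplex], by simp [simplexMap_apply]⟩
    · exact ⟨![0, 1, 0], by simp [solidSimplex], by simp [simplexMap_apply]⟩
    · exact ⟨![0, 0, 1], by simp [solidSimplex], by simp [simplexMap_apply]⟩
    · exact ⟨![0, 0, 0], by simp [solidSimplex], by simp [simplexMap_apply]⟩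
  · rintro _ ⟨y, ⟨h0, h1, h2, h3⟩, rfl⟩ _ ⟨z, ⟨k0, k1, k2, k3⟩, rfl⟩ s t hs ht hst
    refine ⟨s • y + t • z, ⟨?_, ?_, ?_, ?_⟩, ?_⟩
    · simp only [Pi.add_apply, Pi.smul_apply, smul_eq_mul]; positivity
    · simp only [Pi.add_apply, Pi.smul_apply, smul_eq_mul]; positivity
    · simp only [Pi.add_apply, Pi.smul_apply, smul_eq_mul]; positivity
    · simp only [Pi.add_apply, Pi.smul_apply, smul_eq_mul]
      nlinarith [mul_le_mul_of_nonneg_left h3 hs, mul_le_mul_of_nonneg_left k3 ht]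
    · simp only [simplexMap, map_add, map_smul]
      obtain rfl : s = 1 - t := by linarith
      module
  · rintro _ ⟨y, ⟨h0, h1, h2, h3⟩, rfl⟩
    have h := (convex_convexHull ℝ ({a, b, c, d} : Set (Fin 3 → ℝ))).sum_mem
      (t := Finset.univ) (w := ![y 0, y 1, y 2, 1 - y 0 - y 1 - y 2]) (z := ![a, b, c, d])
      (fun i _ => by fin_cases i <;> simp <;> linarith)
      (by simp [Fin.sum_univ_four])
      (fun i _ => subset_convexHull ℝ _ (by fin_cases i <;> simp))
    rw [simplexMap_apply]
    simpa [Fin.sum_univ_four] using h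

theorem volume_convexHull_four_points (a b c d : Fin 3 → ℝ) :
    volume (convexHull ℝ {a, b, c, d}) =
      ENNReal.ofReal (|(Matrix.of ![a - d, b - d, c - d]).det| / 6) := by
  have h : simplexMap a b c d '' solidSimplex = (fun x => x + d) ''
      (Matrix.toLin' (Matrix.of ![a - d, b - d, c - d]).transpose '' solidSimplex) := by
    rw [Set.image_image]
    rfl
  rw [convexHull_eq_image_simplexMap, h, Set.image_add_right, measure_preimage_add_right,
    Measure.addHaar_image_linearMap, LinearMap.det_toLin', Matrix.det_transpose,
    volume_solidSimplex, ← ENNReal.ofReal_mul (abs_nonneg _)]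
  congr 1
  ring

theorem setIntegral_image_simplexMap (a b c d : Fin 3 → ℝ)
    (hdet : (Matrix.of ![a - d, b - d, c - d]).det ≠ 0) (g : (Fin 3 → ℝ) → ℝ) :
    ∫ x in simplexMap a b c d '' solidSimplex, g x =
      |(Matrix.of ![a - d, b - d, c - d]).det| *
        ∫ y in solidSimplex, g (simplexMap a b c d y) := by
  set L := (Matrix.toLin' (Matrix.of ![a - d, b - d, c - d]).transpose).toContinuousLinearMap
    with hL
  have hLdet : L.det = (Matrix.of ![a - d, b - d, c - d]).det := by
    rw [hL, ← Matrix.det_transpose, ← LinearMap.det_toLin']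
    rfl
  have hd (x : Fin 3 → ℝ) : HasFDerivAt (simplexMap a b c d) L x :=
    L.hasFDerivAt.add_const d
  have hinj : Function.Injective (simplexMap a b c d) := by
    intro x y hxy
    have h : (Matrix.of ![a - d, b - d, c - d]).transpose.mulVec x =
      (Matrix.of ![a - d, b - d, c - d]).transpose.mulVec y := by
      simpa [simplexMap] using hxy
    refine Matrix.mulVec_injective_of_isUnit ?_ h
    rw [Matrix.isUnit_iff_isUnit_det, Matrix.det_transpose]
    exact hdet.isUnit
  rw [integral_image_eq_integral_abs_det_fderiv_smul volume
    isCompact_solidSimplex.isClosed.measurableSet (fun x _ => (hd x).hasFDerivWithinAt)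
    hinj.injOn]
  simp only [hLdet, smul_eq_mul, integral_const_mul]

theorem det_simplexMap_sub (a b c d y₁ y₂ y₃ y₀ : Fin 3 → ℝ) :
    (Matrix.of ![simplexMap a b c d y₁ - simplexMap a b c d y₀,
      simplexMap a b c d y₂ - simplexMap a b c d y₀,
      simplexMap a b c d y₃ - simplexMap a b c d y₀]).det =
    (Matrix.of ![a - d, b - d, c - d]).det * (Matrix.of ![y₁ - y₀, y₂ - y₀, y₃ - y₀]).det := by
  rw [mul_comm, ← Matrix.det_mul]
  congr 1
  ext i j
  fin_cases i <;>
    simp [simplexMap_apply, Matrix.mul_apply, Fin.sum_univ_three] <;> ring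

theorem moment_4 (v : Fin 4 → (Fin 3 → ℝ))
    (hv : AffineIndependent ℝ v) (T : Set (Fin 3 → ℝ))
    (hT : T = convexHull ℝ (Set.range v)) (hvol : volume T = 1)
    (c : Fin 3 → ℝ) (hc : c = (3:ℝ)⁻¹ • (v 0 + v 1 + v 2)) :
    (∫ x₁ in T, ∫ x₂ in T, ∫ x₃ in T,
        (volume (convexHull ℝ ({x₁, x₂, x₃, c} : Set (Fin 3 → ℝ)))).toReal ^ 4)
      = 43 / 27783000 := by
  have hr : Set.range v = {v 0, v 1, v 3, v 2} := by
    ext x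
    simp only [Set.mem_range, Fin.exists_fin_succ, Set.mem_insert_iff, Set.mem_singleton_iff]
    simp [eq_comm]
    tauto
  rw [hr] at hT
  have hdet : |(Matrix.of ![v 0 - v 2, v 1 - v 2, v 3 - v 2]).det| = 6 := by
    rw [hT, volume_convexHull_four_points, ENNReal.ofReal_eq_one] at hvol
    linarith
  have hne : (Matrix.of ![v 0 - v 2, v 1 - v 2, v 3 - v 2]).det ≠ 0 := by
    intro h
    norm_num [h] at hdet
  have hc' : c = simplexMap (v 0) (v 1) (v 3) (v 2) facetCentroid := by
    rw [hc, simplexMap_apply]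
    ext i
    simp [facetCentroid]
    ring
  have hvol4 (y₁ y₂ y₃ : Fin 3 → ℝ) :
      (volume (convexHull ℝ {simplexMap (v 0) (v 1) (v 3) (v 2) y₁,
        simplexMap (v 0) (v 1) (v 3) (v 2) y₂, simplexMap (v 0) (v 1) (v 3) (v 2) y₃,
        simplexMap (v 0) (v 1) (v 3) (v 2) facetCentroid})).toReal ^ 4 =
      (Matrix.of ![y₁ - facetCentroid, y₂ - facetCentroid, y₃ - facetCentroid]).det ^ 4 := by
    rw [volume_convexHull_four_points, ENNReal.toReal_ofReal (by positivity),
      det_simplexMap_sub, abs_mul, hdet, mul_div_cancel_left₀ _ (by norm_num),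
      Even.pow_abs (by decide)]
  rw [convexHull_eq_image_simplexMap] at hT
  subst hT hc'
  simp only [setIntegral_image_simplexMap _ _ _ _ hne, hdet, hvol4, integral_const_mul,
    triple_integral_det_pow_four_solidSimplex]
  norm_num
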